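/- arXiv:2302.05540 — 6 statements merged into one kernel-verified Lean document; each statement's English description precedes it below -/
import Mathlib

section
/- Let q ≥ 1, let μ > 0, and let f¹, …, f^q : ℝ^m → ℝ each be continuous and strongly (uniformly) convex with modulus μ, i.e., y ↦ fʲ(y) − (μ/2)‖y‖² is convex for every j. Then the set of weak Pareto minimizers of F = (f¹, …, f^q) is nonempty and compact. -/
theorem coercive_aux {m : ℕ} (μ : ℝ) (hμ : 0 < μ) (f : EuclideanSpace ℝ (Fin m) → ℝ)
    (hc : Continuous f)
    (hs : ConvexOn ℝ Set.univ (fun y => f y - μ / 2 * ‖y‖ ^ 2)) :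
    ∃ R : ℝ, 0 ≤ R ∧ ∀ y, R < ‖y‖ → f 0 < f y := by
  obtain ⟨K, hK⟩ := (isCompact_closedBall (0 : EuclideanSpace ℝ (Fin m)) 1).exists_bound_of_continuousOn
    (f := fun u => (f u - μ / 2 * ‖u‖ ^ 2) - f 0) (by fun_prop)
  have hK0 : 0 ≤ K := (norm_nonneg _).trans (hK 0 (by simp))
  refine ⟨max 1 (2 * K / μ), by positivity, fun y hy => ?_⟩
  obtain ⟨h1, h2⟩ := max_lt_iff.1 hy
  have hr : 0 < ‖y‖ := by linarith
  rw [div_lt_iff₀ hμ] at h2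
  have hb := hK (‖y‖⁻¹ • y) (by simp [norm_smul, hr.ne'])
  have hcv := hs.2 (Set.mem_univ (0 : EuclideanSpace ℝ (Fin m))) (Set.mem_univ y)
    (show 0 ≤ 1 - ‖y‖⁻¹ by linarith [inv_le_one_of_one_le₀ h1.le])
    (show 0 ≤ ‖y‖⁻¹ by positivity) (by ring)
  simp only [smul_zero, zero_add, smul_eq_mul, norm_zero] at hcv
  have hb2 := (abs_le.1 (Real.norm_eq_abs _ ▸ hb)).1
  have h3 : -K ≤ ‖y‖⁻¹ * (f y - μ / 2 * ‖y‖ ^ 2 - f 0) := by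
    linarith
  have h4 : ‖y‖ * (-K) ≤ f y - μ / 2 * ‖y‖ ^ 2 - f 0 := by
    have := mul_le_mul_of_nonneg_left h3 hr.le
    rwa [mul_inv_cancel_left₀ hr.ne'] at this
  nlinarith

/-- If `μ > 0` and each `fʲ` is continuous and strongly convex with modulus `μ`
(i.e. `y ↦ fʲ(y) - (μ/2)‖y‖²` is convex), then the set of weak Pareto minimizers
of `F = (f¹, …, f^q)` is nonempty and compact. -/
theorem weak_pareto_set_nonempty_compact (m q : ℕ) (hq : 1 ≤ q)
    (μ : ℝ) (hμ : 0 < μ)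
    (f : Fin q → EuclideanSpace ℝ (Fin m) → ℝ)
    (hcont : ∀ j, Continuous (f j))
    (hstrong : ∀ j, ConvexOn ℝ Set.univ (fun y => f j y - μ / 2 * ‖y‖ ^ 2)) :
    ({y : EuclideanSpace ℝ (Fin m) | ¬ ∃ ybar, ∀ j, f j ybar < f j y}).Nonempty ∧
    IsCompact {y : EuclideanSpace ℝ (Fin m) | ¬ ∃ ybar, ∀ j, f j ybar < f j y} := by
  choose R hR0 hR using fun j => coercive_aux μ hμ (f j) (hcont j) (hstrong j)
  constructor
  · let j : Fin q := ⟨0, hq⟩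
    obtain ⟨x, -, hx⟩ := (isCompact_closedBall (0 : EuclideanSpace ℝ (Fin m)) (R j)).exists_isMinOn
      ⟨0, by simpa using hR0 j⟩ (hcont j).continuousOn
    refine ⟨x, ?_⟩
    rintro ⟨y, hy⟩
    have hyj := hy j
    have h0 : f j x ≤ f j 0 := hx (by simpa using hR0 j)
    by_cases h : ‖y‖ ≤ R j
    · have : f j x ≤ f j y := hx (by simpa using h)
      linarith
    · have := hR j y (not_le.1 h)
      linarith
  · refine Metric.isCompact_of_isClosed_isBounded ?_ ?_
    · rw [← isOpen_compl_iff]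
      have : {y : EuclideanSpace ℝ (Fin m) | ¬ ∃ ybar, ∀ j, f j ybar < f j y}ᶜ
          = ⋃ ybar, ⋂ j, {y | f j ybar < f j y} := by
        ext y; simp
      rw [this]
      exact isOpen_iUnion fun z => isOpen_iInter_of_finite fun j =>
        isOpen_lt continuous_const (hcont j)
    · refine (Metric.isBounded_closedBall (x := (0 : EuclideanSpace ℝ (Fin m)))
        (r := ∑ j, R j)).subset ?_
      intro y hy
      by_contra h
      refine hy ⟨0, fun j => hR j y ?_⟩
      have h' : ∑ j, R j < ‖y‖ := by simpa using h
      exact (Finset.single_le_sum (fun i _ => hR0 i) (Finset.mem_univ j)).trans_lt h'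
end

section
/- Let f_u : ℝⁿ × ℝ^m → ℝ, let X ⊆ ℝⁿ, and for each x ∈ X let f_ℓ¹(x,·), …, f_ℓ^q(x,·) : ℝ^m → ℝ be strictly convex. For x ∈ X let P(x) denote the set of weak Pareto minimizers of F_ℓ(x,·) = (f_ℓ¹(x,·), …, f_ℓ^q(x,·)), and for (x,λ) ∈ X × Λ let Φ(x,λ) be the set of global minimizers over ℝ^m of y ↦ Σⱼ₌₁^q λⱼ f_ℓʲ(x,y). If (x̄, ȳ) with x̄ ∈ X and ȳ ∈ P(x̄) satisfies f_u(x̄,ȳ) ≤ f_u(x,y) for all x ∈ X and y ∈ P(x), then for every λ̄ ∈ Λ such that ȳ ∈ Φ(x̄, λ̄), the point (x̄, λ̄, ȳ) satisfies f_u(x̄,ȳ) ≤ f_u(x,y) for all x ∈ X, λ ∈ Λ, and y ∈ Φ(x,λ). -/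
/-- Optimistic formulation, first direction: if `(x̄, ȳ)` solves the bilevel problem
over the weak Pareto sets `P(x)`, then for every `λ̄ ∈ Λ` with `ȳ ∈ Φ(x̄, λ̄)`,
the point `(x̄, λ̄, ȳ)` solves the weighted-sum bilevel problem over `Φ(x, λ)`. -/
theorem optimistic_pareto_to_weighted (n m q : ℕ)
    (fu : (Fin n → ℝ) → (Fin m → ℝ) → ℝ)
    (X : Set (Fin n → ℝ))
    (fl : Fin q → (Fin n → ℝ) → (Fin m → ℝ) → ℝ)
    (hconv : ∀ x ∈ X, ∀ j, StrictConvexOn ℝ Set.univ (fl j x))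
    (P : (Fin n → ℝ) → Set (Fin m → ℝ))
    (hP : ∀ x, P x = {y : Fin m → ℝ | ¬ ∃ ybar : Fin m → ℝ, ∀ j, fl j x ybar < fl j x y})
    (Phi : (Fin n → ℝ) → (Fin q → ℝ) → Set (Fin m → ℝ))
    (hPhi : ∀ x lam, Phi x lam =
      {y : Fin m → ℝ | ∀ z : Fin m → ℝ, ∑ j, lam j * fl j x y ≤ ∑ j, lam j * fl j x z})
    (xbar : Fin n → ℝ) (ybar : Fin m → ℝ)
    (hxbar : xbar ∈ X) (hybar : ybar ∈ P xbar)
    (hopt : ∀ x ∈ X, ∀ y ∈ P x, fu xbar ybar ≤ fu x y)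
    (lambar : Fin q → ℝ) (hlambar_nonneg : ∀ j, 0 ≤ lambar j)
    (hlambar_sum : ∑ j, lambar j = 1)
    (hybar_Phi : ybar ∈ Phi xbar lambar) :
    ∀ x ∈ X, ∀ lam : Fin q → ℝ, (∀ j, 0 ≤ lam j) → (∑ j, lam j = 1) →
      ∀ y ∈ Phi x lam, fu xbar ybar ≤ fu x y := by
  intro x hx lam hnn hsum y hy
  apply hopt x hx y
  rw [hP]
  rw [hPhi] at hy
  rintro ⟨z, hz⟩
  have h1 := hy z
  have h2 : ∃ j ∈ Finset.univ, 0 < lam j := by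
    by_contra hcon
    push Not at hcon
    have h3 : ∑ j, lam j ≤ 0 := Finset.sum_nonpos hcon
    linarith
  obtain ⟨j, hj, hpos⟩ := h2
  have h4 : ∑ j, lam j * fl j x z < ∑ j, lam j * fl j x y :=
    Finset.sum_lt_sum (fun i _ => mul_le_mul_of_nonneg_left (hz i).le (hnn i))
      ⟨j, hj, mul_lt_mul_of_pos_left (hz j) hpos⟩
  exact absurd h1 (not_le.mpr h4)
end

section
/- Let f_u : ℝⁿ × ℝ^m → ℝ, let X ⊆ ℝⁿ, and for each x ∈ X let f_ℓ¹(x,·), …, f_ℓ^q(x,·) : ℝ^m → ℝ be strictly convex. For x ∈ X let P(x) denote the set of weak Pareto minimizers of F_ℓ(x,·) = (f_ℓ¹(x,·), …, f_ℓ^q(x,·)), and for (x,λ) ∈ X × Λ let Φ(x,λ) be the set of global minimizers over ℝ^m of y ↦ Σⱼ₌₁^q λⱼ f_ℓʲ(x,y). If (x̄, λ̄, ȳ) with x̄ ∈ X, λ̄ ∈ Λ, and ȳ ∈ Φ(x̄, λ̄) satisfies f_u(x̄,ȳ) ≤ f_u(x,y) for all x ∈ X, λ ∈ Λ, and y ∈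 Φ(x,λ), then (x̄, ȳ) satisfies ȳ ∈ P(x̄) and f_u(x̄,ȳ) ≤ f_u(x,y) for all x ∈ X and y ∈ P(x). -/
theorem scalarize_aux (m q : ℕ) (hq : 0 < q) (g : Fin q → (Fin m → ℝ) → ℝ)
    (hconv : ∀ j, ConvexOn ℝ Set.univ (g j)) (y : Fin m → ℝ)
    (hy : ¬ ∃ z : Fin m → ℝ, ∀ j, g j z < g j y) :
    ∃ lam : Fin q → ℝ, (∀ j, 0 ≤ lam j) ∧ (∑ j, lam j = 1) ∧
      ∀ z : Fin m → ℝ, ∑ j, lam j * g j y ≤ ∑ j, lam j * g j z := by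
  let S : Set (Fin q → ℝ) := ⋃ z : Fin m → ℝ, Set.univ.pi fun j => Set.Ioi (g j z)
  have hmem : ∀ v, v ∈ S ↔ ∃ z, ∀ j, g j z < v j := by
    intro v; simp [S]
  have hopen : IsOpen S :=
    isOpen_iUnion fun z => isOpen_set_pi Set.finite_univ fun j _ => isOpen_Ioi
  have hcvx : Convex ℝ S := by
    intro v hv w hw a b ha hb hab
    obtain ⟨z, hz⟩ := (hmem v).1 hv
    obtain ⟨z', hz'⟩ := (hmem w).1 hw
    refine (hmem _).2 ⟨a • z + b • z', fun j => ?_⟩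
    have h1 := (hconv j).2 (Set.mem_univ z) (Set.mem_univ z') ha hb hab
    refine lt_of_le_of_lt h1 ?_
    simp only [smul_eq_mul, Pi.add_apply, Pi.smul_apply]
    rcases ha.eq_or_lt with h | h
    · subst h
      have : b = 1 := by linarith
      subst this
      simpa using hz' j
    · have h2 := mul_lt_mul_of_pos_left (hz j) h
      have h3 := mul_le_mul_of_nonneg_left (hz' j).le hb
      linarith
  have hp : (fun j => g j y) ∉ S := fun h => hy ((hmem _).1 h)
  obtain ⟨f, hf⟩ := geometric_hahn_banach_point_open hcvx hopen hp
  let c : Fin q → ℝ := fun j => f (Pi.single j 1)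
  have hfc : ∀ v, f v = ∑ j, c j * v j := by
    intro v
    conv_lhs => rw [pi_eq_sum_univ' v]
    rw [map_sum]
    refine Finset.sum_congr rfl fun j _ => ?_
    rw [map_smul, smul_eq_mul, mul_comm]
  have hle : ∀ z, ∀ e : Fin q → ℝ, (∀ j, 0 < e j) →
      ∑ j, c j * g j y < ∑ j, c j * g j z + ∑ j, c j * e j := by
    intro z e he
    have h := hf (fun j => g j z + e j) ((hmem _).2 ⟨z, fun j => by linarith [he j]⟩)
    rw [hfc, hfc] at h
    simpa [mul_add, Finset.sum_add_distrib] using h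
  have hpos : 0 < ∑ j, c j := by
    have := hle y (fun _ => 1) (fun _ => one_pos)
    simp only [mul_one] at this
    linarith
  have hc : ∀ j, 0 ≤ c j := by
    intro j
    by_contra! hj
    have ht : 0 ≤ (∑ j, c j) / (- c j) := div_nonneg hpos.le (by linarith)
    have := hle y (fun i => 1 + Pi.single (M := fun _ => ℝ) j ((∑ j, c j) / (- c j)) i) (fun i => by
      by_cases h : i = j
      · subst h; simp only [Pi.single_eq_same]; linarith
      · simp [h])
    simp only [mul_add, mul_one, Finset.sum_add_distrib] at this
    rw [Finset.sum_eq_single (f := fun i => c i * Pi.single (M := fun _ => ℝ) j _ i) j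
      (by intro b _ hb; simp [hb]) (by simp)] at this
    simp only [Pi.single_eq_same] at this
    have h2 : c j * ((∑ j, c j) / (- c j)) = - ∑ j, c j := by
      have := hj.ne
      field_simp
    linarith
  have hmain : ∀ z, ∑ j, c j * g j y ≤ ∑ j, c j * g j z := by
    intro z
    refine le_of_forall_pos_le_add fun ε hε => ?_
    have := hle z (fun _ => ε / ∑ j, c j) (fun _ => div_pos hε hpos)
    rw [← Finset.sum_mul, mul_div_cancel₀ _ hpos.ne'] at this
    exact this.le
  refine ⟨fun j => c j / ∑ j, c j, fun j => div_nonneg (hc j) hpos.le, ?_, fun z => ?_⟩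
  · rw [← Finset.sum_div, div_self hpos.ne']
  · simp only [div_mul_eq_mul_div, ← Finset.sum_div]
    exact div_le_div_of_nonneg_right (hmain z) hpos.le


/-- Optimistic formulation, second direction: if `(x̄, λ̄, ȳ)` solves the weighted-sum
bilevel problem over `Φ(x, λ)`, then `ȳ ∈ P(x̄)` and `(x̄, ȳ)` solves the bilevel
problem over the weak Pareto sets `P(x)`. -/
theorem optimistic_weighted_to_pareto (n m q : ℕ)
    (fu : (Fin n → ℝ) → (Fin m → ℝ) → ℝ)
    (X : Set (Fin n → ℝ))
    (fl : Fin q → (Fin n → ℝ) → (Fin m → ℝ) → ℝ)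
    (hconv : ∀ x ∈ X, ∀ j, StrictConvexOn ℝ Set.univ (fl j x))
    (P : (Fin n → ℝ) → Set (Fin m → ℝ))
    (hP : ∀ x, P x = {y : Fin m → ℝ | ¬ ∃ ybar : Fin m → ℝ, ∀ j, fl j x ybar < fl j x y})
    (Phi : (Fin n → ℝ) → (Fin q → ℝ) → Set (Fin m → ℝ))
    (hPhi : ∀ x lam, Phi x lam =
      {y : Fin m → ℝ | ∀ z : Fin m → ℝ, ∑ j, lam j * fl j x y ≤ ∑ j, lam j * fl j x z})
    (xbar : Fin n → ℝ) (lambar : Fin q → ℝ) (ybar : Fin m → ℝ)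
    (hxbar : xbar ∈ X) (hlambar_nonneg : ∀ j, 0 ≤ lambar j)
    (hlambar_sum : ∑ j, lambar j = 1)
    (hybar_Phi : ybar ∈ Phi xbar lambar)
    (hopt : ∀ x ∈ X, ∀ lam : Fin q → ℝ, (∀ j, 0 ≤ lam j) → (∑ j, lam j = 1) →
      ∀ y ∈ Phi x lam, fu xbar ybar ≤ fu x y) :
    ybar ∈ P xbar ∧ ∀ x ∈ X, ∀ y ∈ P x, fu xbar ybar ≤ fu x y := by
  have hq : 0 < q := by
    rcases Nat.eq_zero_or_pos q with h | h
    · subst h; simp at hlambar_sum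
    · exact h
  constructor
  · rw [hP]
    rintro ⟨z, hz⟩
    rw [hPhi] at hybar_Phi
    have h1 := hybar_Phi z
    obtain ⟨j, hj⟩ : ∃ j, 0 < lambar j := by
      by_contra! h
      have := Finset.sum_nonpos fun j (_ : j ∈ Finset.univ) => h j
      linarith
    have h2 : ∑ j, lambar j * fl j xbar z < ∑ j, lambar j * fl j xbar ybar :=
      Finset.sum_lt_sum (fun i _ => mul_le_mul_of_nonneg_left (hz i).le (hlambar_nonneg i))
        ⟨j, Finset.mem_univ j, mul_lt_mul_of_pos_left (hz j) hj⟩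
    linarith
  · intro x hx y hy
    rw [hP] at hy
    obtain ⟨lam, h0, h1, h2⟩ := scalarize_aux m q hq (fun j => fl j x)
      (fun j => (hconv x hx j).convexOn) y hy
    exact hopt x hx lam h0 h1 y (by rw [hPhi]; exact h2)
end

section
/- Let f_u : ℝⁿ × ℝ^m → ℝ, let X ⊆ ℝⁿ, and for each x ∈ X let f_ℓ¹(x,·), …, f_ℓ^q(x,·) : ℝ^m → ℝ be strictly convex and differentiable. Let P(x) denote the set of weak Pareto minimizers of F_ℓ(x,·) = (f_ℓ¹(x,·), …, f_ℓ^q(x,·)), and let P̃(x) = {(y,λ) ∈ ℝ^m × ℝ^q : λ ∈ Λ and Σⱼ₌₁^q λⱼ ∇_y f_ℓʲ(x,y) = 0}. Assume that for every x ∈ X the suprema sup{f_u(x,y) : y ∈ P(x)} and sup{f_u(x,y) : (y,λ) ∈ P̃(x)} are attained. Then x̄ ∈ X minimizes x ↦ max{f_u(x,y) : y ∈ P(x)} over X if and only if x̄ minimizes x ↦ max{f_u(x,y) : (y,λ) ∈ P̃(x)} over X. -/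
lemma rae_line {m : ℕ} (f : EuclideanSpace ℝ (Fin m) → ℝ) (hd : Differentiable ℝ f)
    (y d : EuclideanSpace ℝ (Fin m)) :
    HasDerivAt (fun t : ℝ => f (y + t • d)) (inner ℝ (gradient f y) d) 0 := by
  have h1 : HasDerivAt (fun t : ℝ => y + t • d) d 0 := by
    simpa using ((hasDerivAt_id (0:ℝ)).smul_const d).const_add y
  have h2 : HasFDerivAt f (InnerProductSpace.toDual ℝ _ (gradient f y)) (y + (0:ℝ) • d) := by
    simpa using (hd y).hasGradientAt.hasFDerivAt
  have h3 := h2.comp_hasDerivAt (0:ℝ) h1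
  rw [InnerProductSpace.toDual_apply_apply] at h3
  exact h3

lemma rae_grad {m : ℕ} (f : EuclideanSpace ℝ (Fin m) → ℝ) (hd : Differentiable ℝ f)
    (hc : ConvexOn ℝ Set.univ f) (y z : EuclideanSpace ℝ (Fin m)) :
    inner ℝ (gradient f y) (z - y) ≤ f z - f y := by
  have h := rae_line f hd y (z - y)
  have hc' : ConvexOn ℝ Set.univ (fun t : ℝ => f (y + t • (z - y))) := by
    refine ⟨convex_univ, fun a _ b _ s t hs ht hst => ?_⟩
    have := hc.2 (Set.mem_univ (y + a • (z - y))) (Set.mem_univ (y + b • (z - y))) hs ht hst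
    convert this using 2
    have : y = (s + t) • y := by simp [hst]
    simp only [smul_eq_mul]
    nth_rewrite 1 [this]
    module
  have := hc'.le_slope_of_hasDerivAt (Set.mem_univ 0) (Set.mem_univ 1) one_pos h
  simpa [slope_def_field] using this

lemma rae_desc {m : ℕ} (f : EuclideanSpace ℝ (Fin m) → ℝ) (hd : Differentiable ℝ f)
    (y d : EuclideanSpace ℝ (Fin m)) (h : inner ℝ (gradient f y) d < 0) :
    ∀ᶠ t : ℝ in nhdsWithin 0 (Set.Ioi 0), f (y + t • d) < f y := by
  have h1 := (hasDerivAt_iff_tendsto_slope.1 (rae_line f hd y d)).eventually_lt_const h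
  have h2 := h1.filter_mono (nhdsWithin_mono (0:ℝ) (fun t (ht : 0 < t) => (ne_of_gt ht)))
  filter_upwards [h2, self_mem_nhdsWithin] with t ht ht0
  have ht0' : 0 < t := ht0
  simp only [slope_def_field, zero_smul, add_zero, sub_zero] at ht
  rw [div_lt_iff₀ ht0'] at ht
  linarith

lemma rae_main {m q : ℕ} (f : Fin q → EuclideanSpace ℝ (Fin m) → ℝ)
    (hd : ∀ j, Differentiable ℝ (f j)) (hc : ∀ j, ConvexOn ℝ Set.univ (f j))
    (y : EuclideanSpace ℝ (Fin m)) :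
    (¬ ∃ z, ∀ j, f j z < f j y) ↔ ∃ l : Fin q → ℝ, (∀ j, 0 ≤ l j) ∧ (∑ j, l j = 1) ∧
      ∑ j, l j • gradient (f j) y = 0 := by
  constructor
  · intro hy
    by_contra hl
    apply hy
    let L : (Fin q → ℝ) →ₗ[ℝ] EuclideanSpace ℝ (Fin m) :=
      Fintype.linearCombination ℝ (fun j => gradient (f j) y)
    have hL : ∀ l, L l = ∑ j, l j • gradient (f j) y := fun l =>
      Fintype.linearCombination_apply ℝ _ l
    have hcont : Continuous L := L.continuous_of_finiteDimensional
    have hK : IsClosed (L '' stdSimplex ℝ (Fin q)) :=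
      ((isCompact_stdSimplex ℝ (Fin q)).image hcont).isClosed
    have h0 : (0 : EuclideanSpace ℝ (Fin m)) ∉ L '' stdSimplex ℝ (Fin q) := by
      rintro ⟨l, hl1, hl2⟩
      exact hl ⟨l, hl1.1, hl1.2, by rw [← hL, hl2]⟩
    obtain ⟨φ, u, hu, hu0⟩ := geometric_hahn_banach_closed_point
      ((convex_stdSimplex ℝ (Fin q)).linear_image L) hK h0
    rw [map_zero] at hu0
    let d := (InnerProductSpace.toDual ℝ _).symm φ
    have hneg : ∀ j, inner ℝ (gradient (f j) y) d < 0 := by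
      intro j
      have := hu (L (Pi.single j 1)) ⟨_, single_mem_stdSimplex ℝ j, rfl⟩
      have e : L (Pi.single j 1) = gradient (f j) y := by
        simp [L]
      rw [e] at this
      have e2 : inner ℝ (gradient (f j) y) d = φ (gradient (f j) y) := by
        rw [real_inner_comm]; exact InnerProductSpace.toDual_symm_apply
      rw [e2]; exact this.trans hu0
    have := Filter.eventually_all.2 (fun j => rae_desc (f j) (hd j) y d (hneg j))
    obtain ⟨t, ht⟩ := this.exists
    exact ⟨_, ht⟩
  · rintro ⟨l, h0, h1, hs⟩ ⟨z, hz⟩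
    have hg : ∀ j, inner ℝ (gradient (f j) y) (z - y) < 0 := fun j =>
      (rae_grad (f j) (hd j) (hc j) y z).trans_lt (sub_neg.2 (hz j))
    have hsum : ∑ j, l j * inner ℝ (gradient (f j) y) (z - y) = 0 := by
      have := congrArg (fun v => inner ℝ v (z - y)) hs
      simpa [sum_inner, real_inner_smul_left] using this
    have hall := (Finset.sum_eq_zero_iff_of_nonpos
      (fun j _ => mul_nonpos_of_nonneg_of_nonpos (h0 j) (hg j).le)).1 hsum
    have : ∑ j, l j = 0 := Finset.sum_eq_zero fun j hj =>
      (mul_eq_zero.1 (hall j hj)).resolve_right (hg j).ne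
    linarith

/-- Risk-averse equivalence: minimizing `x ↦ max{f_u(x,y) : y ∈ P(x)}` over `X` is
the same as minimizing `x ↦ max{f_u(x,y) : (y,λ) ∈ P̃(x)}` over `X`, where `P(x)` is
the set of weak Pareto minimizers of the strictly convex differentiable lower-level
objectives and `P̃(x)` is its first-order (stationarity) description. -/
theorem risk_averse_equivalence (n m q : ℕ)
    (fu : EuclideanSpace ℝ (Fin n) → EuclideanSpace ℝ (Fin m) → ℝ)
    (X : Set (EuclideanSpace ℝ (Fin n)))
    (fl : Fin q → EuclideanSpace ℝ (Fin n) → EuclideanSpace ℝ (Fin m) → ℝ)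
    (hconv : ∀ x ∈ X, ∀ j, StrictConvexOn ℝ Set.univ (fl j x))
    (hdiff : ∀ x ∈ X, ∀ j, Differentiable ℝ (fl j x))
    (P : EuclideanSpace ℝ (Fin n) → Set (EuclideanSpace ℝ (Fin m)))
    (hP : ∀ x, P x = {y | ¬ ∃ ybar : EuclideanSpace ℝ (Fin m), ∀ j, fl j x ybar < fl j x y})
    (Pt : EuclideanSpace ℝ (Fin n) → Set (EuclideanSpace ℝ (Fin m) × (Fin q → ℝ)))
    (hPt : ∀ x, Pt x = {p | (∀ j, 0 ≤ p.2 j) ∧ (∑ j, p.2 j = 1) ∧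
      ∑ j, p.2 j • gradient (fl j x) p.1 = 0})
    (hattP : ∀ x ∈ X, ∃ y ∈ P x, ∀ y' ∈ P x, fu x y' ≤ fu x y)
    (hattPt : ∀ x ∈ X, ∃ p ∈ Pt x, ∀ p' ∈ Pt x, fu x p'.1 ≤ fu x p.1)
    (xbar : EuclideanSpace ℝ (Fin n)) (hxbar : xbar ∈ X) :
    (∀ x ∈ X, sSup (fu xbar '' P xbar) ≤ sSup (fu x '' P x)) ↔
    (∀ x ∈ X, sSup ((fun p => fu xbar p.1) '' Pt xbar) ≤
      sSup ((fun p => fu x p.1) '' Pt x)) := by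
  have key : ∀ x ∈ X, (fun p : EuclideanSpace ℝ (Fin m) × (Fin q → ℝ) => fu x p.1) '' Pt x
      = fu x '' P x := by
    intro x hx
    have hm := rae_main (fun j => fl j x) (hdiff x hx) (fun j => (hconv x hx j).convexOn)
    ext r
    rw [hP, hPt]
    constructor
    · rintro ⟨p, hp, rfl⟩
      exact ⟨p.1, (hm p.1).2 ⟨p.2, hp⟩, rfl⟩
    · rintro ⟨y, hy, rfl⟩
      obtain ⟨l, hl⟩ := (hm y).1 hy
      exact ⟨(y, l), hl, rfl⟩
  constructor
  · intro h x hx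
    rw [key x hx, key xbar hxbar]
    exact h x hx
  · intro h x hx
    rw [← key x hx, ← key xbar hxbar]
    exact h x hx
end

section
/- Let f_u : ℝⁿ × ℝ^m → ℝ be continuously differentiable, let f_ℓ : ℝⁿ × ℝ^m → ℝ be twice continuously differentiable, let U ⊆ ℝⁿ be open, and let y : U → ℝ^m be differentiable at x ∈ U with ∇_y f_ℓ(x', y(x')) = 0 for all x' ∈ U and with ∇²_{yy} f_ℓ(x, y(x)) invertible. Then the function f(x') = f_u(x', y(x')) is differentiable at x and its gradient is given by the adjoint formula ∇f(x) = ∇_x f_u(x,y(x)) − ∇²_{xy} f_ℓ(x,y(x)) (∇²_{yy} f_ℓ(x,y(x)))⁻¹ ∇_y f_u(x,y(x)). -/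
theorem agf_chain {E F W : Type*} [NormedAddCommGroup E] [NormedSpace ℝ E]
    [NormedAddCommGroup F] [NormedSpace ℝ F] [NormedAddCommGroup W] [NormedSpace ℝ W]
    (G : E × F → W) (y : E → F) (x : E) (hG : DifferentiableAt ℝ G (x, y x))
    (hy : DifferentiableAt ℝ y x) :
    HasFDerivAt (fun x' => G (x', y x'))
      (fderiv ℝ (fun x' => G (x', y x)) x +
        (fderiv ℝ (fun z => G (x, z)) (y x)).comp (fderiv ℝ y x)) x := by
  have h1 : HasFDerivAt (fun x' => G (x', y x))
      ((fderiv ℝ G (x, y x)).comp (ContinuousLinearMap.inl ℝ E F)) x :=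
    HasFDerivAt.comp x (g := G) (f := fun x' => (x', y x)) hG.hasFDerivAt
      (hasFDerivAt_prodMk_left x (y x))
  have h2 : HasFDerivAt (fun z => G (x, z))
      ((fderiv ℝ G (x, y x)).comp (ContinuousLinearMap.inr ℝ E F)) (y x) :=
    HasFDerivAt.comp (y x) (g := G) (f := fun z => (x, z)) hG.hasFDerivAt
      (hasFDerivAt_prodMk_right x (y x))
  have h3 : HasFDerivAt (fun x' => G (x', y x'))
      ((fderiv ℝ G (x, y x)).comp ((ContinuousLinearMap.id ℝ E).prod (fderiv ℝ y x))) x :=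
    HasFDerivAt.comp x (g := G) (f := fun x' => (x', y x')) hG.hasFDerivAt
      ((hasFDerivAt_id x).prodMk hy.hasFDerivAt)
  rw [h1.fderiv, h2.fderiv]
  convert h3 using 1
  ext v
  simp [← map_add]

noncomputable def agfR (F : Type*) [NormedAddCommGroup F] [InnerProductSpace ℝ F]
    [CompleteSpace F] : (F →L[ℝ] ℝ) →L[ℝ] F where
  toFun := fun l => (InnerProductSpace.toDual ℝ F).symm l
  map_add' := fun a b => map_add _ a b
  map_smul' := fun c a => by simp
  cont := (InnerProductSpace.toDual ℝ F).symm.continuous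

theorem agf_symm {F : Type*} [NormedAddCommGroup F] [InnerProductSpace ℝ F] [CompleteSpace F]
    (g : F → ℝ) (hg : ContDiff ℝ 2 g) (z u v : F) :
    inner ℝ (fderiv ℝ (fun z => gradient g z) z u) v =
      inner ℝ u (fderiv ℝ (fun z => gradient g z) z v) := by
  have hd : DifferentiableAt ℝ (fderiv ℝ g) z :=
    (hg.fderiv_right (m := 1) (by norm_num)).differentiable (by norm_num) z
  have key : ∀ u v : F, inner ℝ (fderiv ℝ (fun z => gradient g z) z u) v =
      fderiv ℝ (fderiv ℝ g) z u v := by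
    intro u v
    have h : HasFDerivAt (fun z => gradient g z)
        ((agfR F).comp (fderiv ℝ (fderiv ℝ g) z)) z :=
      (agfR F).hasFDerivAt.comp z hd.hasFDerivAt
    rw [h.fderiv]
    exact InnerProductSpace.toDual_symm_apply
  rw [key, real_inner_comm, key]
  exact (hg.contDiffAt.isSymmSndFDerivAt (by simp)) u v

/-- Adjoint (hypergradient) formula: if `f_u` is C¹, `f_ℓ` is C², `y(·)` is
differentiable at `x` with `∇_y f_ℓ(x', y(x')) = 0` on an open neighborhood `U` of
`x`, and the Hessian `H = ∇²_{yy} f_ℓ(x, y(x))` is invertible (with two-sided inverse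
`Hinv`), then `f(x') = f_u(x', y(x'))` is differentiable at `x` with
`∇f(x) = ∇_x f_u - ∇²_{xy} f_ℓ H⁻¹ ∇_y f_u`, where `∇²_{xy} f_ℓ` is the adjoint of
`B = ∇²_{yx} f_ℓ(x, y(x))`. -/
theorem adjoint_gradient_formula (n m : ℕ)
    (fu : EuclideanSpace ℝ (Fin n) → EuclideanSpace ℝ (Fin m) → ℝ)
    (hfu : ContDiff ℝ 1 (fun p : EuclideanSpace ℝ (Fin n) × EuclideanSpace ℝ (Fin m) =>
      fu p.1 p.2))
    (fl : EuclideanSpace ℝ (Fin n) → EuclideanSpace ℝ (Fin m) → ℝ)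
    (hfl : ContDiff ℝ 2 (fun p : EuclideanSpace ℝ (Fin n) × EuclideanSpace ℝ (Fin m) =>
      fl p.1 p.2))
    (U : Set (EuclideanSpace ℝ (Fin n))) (hU : IsOpen U)
    (y : EuclideanSpace ℝ (Fin n) → EuclideanSpace ℝ (Fin m))
    (x : EuclideanSpace ℝ (Fin n)) (hx : x ∈ U)
    (hy : DifferentiableAt ℝ y x)
    (hcrit : ∀ x' ∈ U, gradient (fl x') (y x') = 0)
    (H : EuclideanSpace ℝ (Fin m) →L[ℝ] EuclideanSpace ℝ (Fin m))
    (hH : H = fderiv ℝ (fun z => gradient (fl x) z) (y x))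
    (Hinv : EuclideanSpace ℝ (Fin m) →L[ℝ] EuclideanSpace ℝ (Fin m))
    (hHinv₁ : H.comp Hinv = ContinuousLinearMap.id ℝ (EuclideanSpace ℝ (Fin m)))
    (hHinv₂ : Hinv.comp H = ContinuousLinearMap.id ℝ (EuclideanSpace ℝ (Fin m)))
    (B : EuclideanSpace ℝ (Fin n) →L[ℝ] EuclideanSpace ℝ (Fin m))
    (hB : B = fderiv ℝ (fun x' => gradient (fl x') (y x)) x) :
    DifferentiableAt ℝ (fun x' => fu x' (y x')) x ∧
    gradient (fun x' => fu x' (y x')) x =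
      gradient (fun x' => fu x' (y x)) x -
        (ContinuousLinearMap.adjoint B) (Hinv (gradient (fun z => fu x z) (y x))) := by
  have hlc := agf_chain (fun p : EuclideanSpace ℝ (Fin n) × EuclideanSpace ℝ (Fin m) =>
    gradient (fl p.1) p.2) y x ?_ hy
  · have huc := agf_chain _ y x (hfu.differentiable (by norm_num) (x, y x)) hy
    refine ⟨huc.differentiableAt, ?_⟩
    simp only [← hH, ← hB] at hlc
    have hz : HasFDerivAt (fun x' => gradient (fl x') (y x'))
        (0 : EuclideanSpace ℝ (Fin n) →L[ℝ] EuclideanSpace ℝ (Fin m)) x := by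
      refine (hasFDerivAt_const (0 : EuclideanSpace ℝ (Fin m)) x).congr_of_eventuallyEq ?_
      filter_upwards [hU.mem_nhds hx] with x' hx' using hcrit x' hx'
    have h0 := hlc.unique hz
    have hsymH : ∀ u v, inner ℝ (H u) v = inner ℝ u (H v) := by
      intro u v
      rw [hH]
      exact agf_symm (fl x) (hfl.comp (contDiff_const.prodMk contDiff_id)) (y x) u v
    have hi1 : ∀ a, H (Hinv a) = a := fun a => DFunLike.congr_fun hHinv₁ a
    have hi2 : ∀ a, Hinv (H a) = a := fun a => DFunLike.congr_fun hHinv₂ a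
    have hsymI : ∀ u v, inner ℝ (Hinv u) v = inner ℝ u (Hinv v) := by
      intro u v
      have := hsymH (Hinv u) (Hinv v)
      rw [hi1, hi1] at this
      exact this.symm
    refine ext_inner_right ℝ fun v => ?_
    have hv : B v + H (fderiv ℝ y x v) = 0 := DFunLike.congr_fun h0 v
    have hyv : Hinv (B v) = - fderiv ℝ y x v := by
      rw [eq_neg_of_add_eq_zero_left hv, map_neg, hi2]
    rw [inner_sub_left, ContinuousLinearMap.adjoint_inner_left, hsymI, hyv, inner_neg_right]
    simp only [gradient, InnerProductSpace.toDual_symm_apply]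
    rw [huc.fderiv]
    simp
  · have hC : ContDiff ℝ 1 (fun p : EuclideanSpace ℝ (Fin n) × EuclideanSpace ℝ (Fin m) =>
        fderiv ℝ (fl p.1) p.2) :=
      ContDiff.fderiv (f := fun p : EuclideanSpace ℝ (Fin n) × EuclideanSpace ℝ (Fin m) => fl p.1)
        (hfl.comp ((contDiff_fst.comp contDiff_fst).prodMk contDiff_snd)) contDiff_snd
        (by norm_num)
    exact (agfR (EuclideanSpace ℝ (Fin m))).differentiableAt.comp _
        (hC.differentiable (by norm_num) (x, y x))
end

section
/- Let f_u : ℝⁿ × ℝ^m → ℝ be continuously differentiable, let f_ℓ¹, …, f_ℓ^q : ℝⁿ × ℝ^m → ℝ be twice continuously differentiable, fix λ ∈ Λ, let U ⊆ ℝⁿ be open, and let y : U → ℝ^m be differentiable at x ∈ U with Σⱼ₌₁^q λⱼ ∇_y f_ℓʲ(x', y(x')) = 0 for all x' ∈ U and with H(x) = Σⱼ₌₁^q λⱼ ∇²_{yy} f_ℓʲ(x, y(x)) invertible. Then the function x' ↦ f_u(x', y(x')) is differentiable at x with gradient ∇_x f_u(x,y(x)) − (Σⱼ₌₁^q λⱼ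 ∇²_{xy} f_ℓʲ(x,y(x))) H(x)⁻¹ ∇_y f_u(x,y(x)). -/
theorem aux_chain {X Y Z : Type*} [NormedAddCommGroup X] [NormedSpace ℝ X]
    [NormedAddCommGroup Y] [NormedSpace ℝ Y] [NormedAddCommGroup Z] [NormedSpace ℝ Z]
    (F : X → Y → Z) (y : X → Y) (x : X)
    (hF : DifferentiableAt ℝ (fun p : X × Y => F p.1 p.2) (x, y x))
    (hy : DifferentiableAt ℝ y x) :
    HasFDerivAt (fun x' => F x' (y x'))
      (fderiv ℝ (fun x' => F x' (y x)) x + (fderiv ℝ (fun z => F x z) (y x)).comp (fderiv ℝ y x))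
      x := by
  have h := hF.hasFDerivAt
  have h1 : HasFDerivAt (fun x' => F x' (y x)) _ x :=
    HasFDerivAt.comp (g := fun p : X × Y => F p.1 p.2) (f := fun x' => (x', y x)) x h
      ((hasFDerivAt_id x).prodMk (hasFDerivAt_const (y x) x))
  have h2 : HasFDerivAt (fun z => F x z) _ (y x) :=
    HasFDerivAt.comp (g := fun p : X × Y => F p.1 p.2) (f := fun z => (x, z)) (y x) h
      ((hasFDerivAt_const x (y x)).prodMk (hasFDerivAt_id (y x)))
  have h3 : HasFDerivAt (fun x' => F x' (y x')) _ x :=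
    HasFDerivAt.comp (g := fun p : X × Y => F p.1 p.2) (f := fun x' => (x', y x')) x h
      ((hasFDerivAt_id x).prodMk hy.hasFDerivAt)
  refine h3.congr_fderiv ?_
  rw [h1.fderiv, h2.fderiv]
  ext v
  simp [← map_add]

theorem aux_grad_contDiff {X Y : Type*} [NormedAddCommGroup X] [NormedSpace ℝ X]
    [NormedAddCommGroup Y] [InnerProductSpace ℝ Y] [CompleteSpace Y]
    (f : X → Y → ℝ) (hf : ContDiff ℝ 2 (fun p : X × Y => f p.1 p.2)) :
    ContDiff ℝ 1 (fun p : X × Y => gradient (f p.1) p.2) := by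
  unfold gradient
  refine (InnerProductSpace.toDual ℝ Y).symm.toContinuousLinearEquiv.contDiff.comp ?_
  refine ContDiff.fderiv (n := 1) (m := 2) (f := fun (p : X × Y) z => f p.1 z) (g := fun p => p.2) ?_
    contDiff_snd (by norm_num)
  exact hf.comp ((contDiff_fst.comp contDiff_fst).prodMk contDiff_snd)

theorem aux_symm {Y : Type*}
    [NormedAddCommGroup Y] [InnerProductSpace ℝ Y] [CompleteSpace Y]
    (f : Y → ℝ) (hf : ContDiff ℝ 2 f) (z u v : Y) :
    inner ℝ (fderiv ℝ (fun z => gradient f z) z u) v =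
      inner ℝ u (fderiv ℝ (fun z => gradient f z) z v) := by
  have hs : IsSymmSndFDerivAt ℝ f z := hf.contDiffAt.isSymmSndFDerivAt (by simp)
  have hd : DifferentiableAt ℝ (fderiv ℝ f) z :=
    (hf.fderiv_right (m := 1) (by norm_num)).differentiable (by norm_num) z
  have key : ∀ w, fderiv ℝ (fun z => gradient f z) z w =
      (InnerProductSpace.toDual ℝ Y).symm (fderiv ℝ (fderiv ℝ f) z w) := by
    intro w
    have := ((InnerProductSpace.toDual ℝ Y).symm.toContinuousLinearEquiv.hasFDerivAt
      (x := fderiv ℝ f z)).comp z hd.hasFDerivAt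
    have h2 : HasFDerivAt (fun z => gradient f z) _ z := this
    rw [h2.fderiv]
    rfl
  rw [key, key, real_inner_comm _ u, InnerProductSpace.toDual_symm_apply,
    InnerProductSpace.toDual_symm_apply]
  exact hs u v



/-- Adjoint gradient formula for the weighted lower-level problem: if `f_u` is C¹,
each `f_ℓʲ` is C², `λ` lies in the simplex, `y(·)` is differentiable at `x` with
`∑ j, λ j • ∇_y f_ℓʲ(x', y(x')) = 0` on an open neighborhood `U` of `x`, and
`H(x) = ∑ j, λ j • ∇²_{yy} f_ℓʲ(x, y(x))` is invertible (with two-sided inverse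
`Hinv`), then `x' ↦ f_u(x', y(x'))` is differentiable at `x` with gradient
`∇_x f_u - (∑ j, λ j ∇²_{xy} f_ℓʲ) H(x)⁻¹ ∇_y f_u`, where `∇²_{xy} f_ℓʲ` is the
adjoint of `B j = ∇²_{yx} f_ℓʲ(x, y(x))`. -/
theorem adjoint_gradient_formula_weighted (n m q : ℕ)
    (fu : EuclideanSpace ℝ (Fin n) → EuclideanSpace ℝ (Fin m) → ℝ)
    (hfu : ContDiff ℝ 1 (fun p : EuclideanSpace ℝ (Fin n) × EuclideanSpace ℝ (Fin m) =>
      fu p.1 p.2))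
    (fl : Fin q → EuclideanSpace ℝ (Fin n) → EuclideanSpace ℝ (Fin m) → ℝ)
    (hfl : ∀ j, ContDiff ℝ 2
      (fun p : EuclideanSpace ℝ (Fin n) × EuclideanSpace ℝ (Fin m) => fl j p.1 p.2))
    (lam : Fin q → ℝ) (hlam_nonneg : ∀ j, 0 ≤ lam j) (hlam_sum : ∑ j, lam j = 1)
    (U : Set (EuclideanSpace ℝ (Fin n))) (hU : IsOpen U)
    (y : EuclideanSpace ℝ (Fin n) → EuclideanSpace ℝ (Fin m))
    (x : EuclideanSpace ℝ (Fin n)) (hx : x ∈ U)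
    (hy : DifferentiableAt ℝ y x)
    (hcrit : ∀ x' ∈ U, ∑ j, lam j • gradient (fl j x') (y x') = 0)
    (H : EuclideanSpace ℝ (Fin m) →L[ℝ] EuclideanSpace ℝ (Fin m))
    (hH : H = ∑ j, lam j • fderiv ℝ (fun z => gradient (fl j x) z) (y x))
    (Hinv : EuclideanSpace ℝ (Fin m) →L[ℝ] EuclideanSpace ℝ (Fin m))
    (hHinv₁ : H.comp Hinv = ContinuousLinearMap.id ℝ (EuclideanSpace ℝ (Fin m)))
    (hHinv₂ : Hinv.comp H = ContinuousLinearMap.id ℝ (EuclideanSpace ℝ (Fin m)))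
    (B : Fin q → (EuclideanSpace ℝ (Fin n) →L[ℝ] EuclideanSpace ℝ (Fin m)))
    (hB : ∀ j, B j = fderiv ℝ (fun x' => gradient (fl j x') (y x)) x) :
    DifferentiableAt ℝ (fun x' => fu x' (y x')) x ∧
    gradient (fun x' => fu x' (y x')) x =
      gradient (fun x' => fu x' (y x)) x -
        (∑ j, lam j • ContinuousLinearMap.adjoint (B j))
          (Hinv (gradient (fun z => fu x z) (y x))) := by
  have hA := aux_chain fu y x (hfu.differentiable (by norm_num) _) hy
  refine ⟨hA.differentiableAt, ?_⟩
  have hG : ∀ j, HasFDerivAt (fun x' => gradient (fl j x') (y x'))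
      (B j + (fderiv ℝ (fun z => gradient (fl j x) z) (y x)).comp (fderiv ℝ y x)) x := by
    intro j
    rw [hB j]
    exact aux_chain (fun a b => gradient (fl j a) b) y x
      ((aux_grad_contDiff (fl j) (hfl j)).differentiable (by norm_num) _) hy
  have hsum : HasFDerivAt (fun x' => ∑ j, lam j • gradient (fl j x') (y x')) _ x :=
    HasFDerivAt.fun_sum (fun j _ => (hG j).const_smul (lam j))
  have hzero : HasFDerivAt (fun x' => ∑ j, lam j • gradient (fl j x') (y x'))
      (0 : EuclideanSpace ℝ (Fin n) →L[ℝ] EuclideanSpace ℝ (Fin m)) x := by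
    refine (hasFDerivAt_const (0 : EuclideanSpace ℝ (Fin m)) x).congr_of_eventuallyEq ?_
    filter_upwards [hU.mem_nhds hx] with x' hx' using hcrit x' hx'
  have heq := hsum.unique hzero
  have hEq : ∀ v, (∑ j, lam j • B j v) + H (fderiv ℝ y x v) = 0 := by
    intro v
    have := congrArg (fun L => L v) heq
    rw [hH]
    simpa [Finset.sum_add_distrib, ContinuousLinearMap.sum_apply] using this
  have hsym : ∀ u v, inner ℝ (H u) v = inner ℝ u (H v) := by
    intro u v
    rw [hH]
    simp only [ContinuousLinearMap.sum_apply, ContinuousLinearMap.smul_apply, sum_inner,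
      inner_sum, real_inner_smul_left, real_inner_smul_right]
    refine Finset.sum_congr rfl fun j _ => ?_
    rw [aux_symm (fl j x) ((hfl j).comp (contDiff_const.prodMk contDiff_id))]
  have hr : ∀ u, H (Hinv u) = u := fun u => congrArg (fun L => L u) hHinv₁
  refine ext_inner_right ℝ fun v => ?_
  have hgr : ∀ {k : ℕ} (f : EuclideanSpace ℝ (Fin k) → ℝ) (a w : EuclideanSpace ℝ (Fin k)),
      inner ℝ (gradient f a) w = fderiv ℝ f a w := by
    intro k f a w
    unfold gradient
    rw [InnerProductSpace.toDual_symm_apply]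
  rw [inner_sub_left, hgr, hgr, hA.fderiv]
  set g := gradient (fun z => fu x z) (y x) with hg
  have h1 : fderiv ℝ (fun z => fu x z) (y x) (fderiv ℝ y x v)
      = inner ℝ (Hinv g) (H (fderiv ℝ y x v)) := by
    rw [← hgr, ← hsym, hr]
  have h2 : inner ℝ ((∑ j, lam j • ContinuousLinearMap.adjoint (B j)) (Hinv g)) v
      = inner ℝ (Hinv g) (∑ j, lam j • B j v) := by
    simp only [ContinuousLinearMap.sum_apply, ContinuousLinearMap.smul_apply, sum_inner,
      inner_sum, real_inner_smul_left, real_inner_smul_right,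
      ContinuousLinearMap.adjoint_inner_left]
  rw [h2, eq_neg_of_add_eq_zero_left (hEq v), inner_neg_right, ContinuousLinearMap.add_apply,
    ContinuousLinearMap.comp_apply, h1]
  ring
end
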